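/- Let k be a field of characteristic not two containing an element i with i^2 = -1, and let S = k[[x,y,u,v]]/(x^2 y + u^2 + v^2). For an integer n ≥ 1 let φ_n = [[x, y^n],[0, -x]] and ψ_n = [[xy, y^{n+1}],[0, -xy]] (2×2 matrices over S, entries being residue classes), and let φ_n^{##} be the 4×4 block matrix [[φ_n, (u + iv)·1_2],[(-u + iv)·1_2, ψ_n]] over S, where 1_2 is the 2×2 identity matrix. Define N_n = coker of the S-linear map S^{⊕4} → S^{⊕4} given by φ_n^{##}. Then N_n ⇒_deg N_{n+2}. -/

import Mathlib

open Polynomial TensorProduct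

noncomputable section

/-- The prime ideal `(t)` of the polynomial ring `k[t]`. -/
def tIdeal (k : Type) [Field k] : Ideal (Polynomial k) := Ideal.span {Polynomial.X}

instance tIdeal_isPrime (k : Type) [Field k] : (tIdeal k).IsPrime := by
  have h : tIdeal k = RingHom.ker (Polynomial.evalRingHom (0 : k)) := by
    rw [Polynomial.ker_evalRingHom]
    simp [tIdeal]
  rw [h]
  exact RingHom.ker_isPrime _

/-- `V = k[t]_{(t)}`, the localization of the polynomial ring `k[t]` at the prime ideal `(t)`. -/
def DegV (k : Type) [Field k] : Type := Localization.AtPrime (tIdeal k)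

instance (k : Type) [Field k] : CommRing (DegV k) :=
  inferInstanceAs (CommRing (Localization.AtPrime (tIdeal k)))

instance (k : Type) [Field k] : Algebra (Polynomial k) (DegV k) :=
  inferInstanceAs (Algebra (Polynomial k) (Localization.AtPrime (tIdeal k)))

instance (k : Type) [Field k] : Algebra k (DegV k) :=
  inferInstanceAs (Algebra k (Localization.AtPrime (tIdeal k)))

instance (k : Type) [Field k] : IsScalarTower k (Polynomial k) (DegV k) :=
  inferInstanceAs (IsScalarTower k (Polynomial k) (Localization.AtPrime (tIdeal k)))

/-- The element `t` of `V = k[t]_{(t)}`. -/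
def degT (k : Type) [Field k] : DegV k := algebraMap (Polynomial k) (DegV k) Polynomial.X

/-- `K = V[t⁻¹]`, which is the fraction field `k(t)` of `V = k[t]_{(t)}`. -/
def DegK (k : Type) [Field k] : Type := Localization (Submonoid.powers (degT k))

instance (k : Type) [Field k] : CommRing (DegK k) :=
  inferInstanceAs (CommRing (Localization (Submonoid.powers (degT k))))

instance (k : Type) [Field k] : Algebra (DegV k) (DegK k) :=
  inferInstanceAs (Algebra (DegV k) (Localization (Submonoid.powers (degT k))))

instance (k : Type) [Field k] : Algebra k (DegK k) :=
  inferInstanceAs (Algebra k (Localization (Submonoid.powers (degT k))))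

/-- The localized module `Q[t⁻¹]` is a module over `K = V[t⁻¹]`. -/
instance (k : Type) [Field k] (Q : Type) [AddCommGroup Q] [Module (DegV k) Q] :
    Module (DegK k) (LocalizedModule (Submonoid.powers (degT k)) Q) :=
  inferInstanceAs (Module (Localization (Submonoid.powers (degT k)))
    (LocalizedModule (Submonoid.powers (degT k)) Q))

section

variable (k : Type) [Field k] (R : Type) [Ring R] [Algebra k R]

/-- `1 ⊗ t` is central in `R ⊗[k] V`. -/
theorem degT_central (x : R ⊗[k] DegV k) :
    x * ((1 : R) ⊗ₜ[k] degT k) = ((1 : R) ⊗ₜ[k] degT k) * x := by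
  induction x with
  | zero => simp
  | tmul a v => simp [Algebra.TensorProduct.tmul_mul_tmul, mul_comm]
  | add x y hx hy => simp [add_mul, mul_add, hx, hy]

/-- Multiplication by `1 ⊗ t` on an `R ⊗[k] V`-module, as an `R ⊗[k] V`-linear map. -/
def tSmul (Q : Type) [AddCommGroup Q] [Module (R ⊗[k] DegV k) Q] :
    Q →ₗ[R ⊗[k] DegV k] Q where
  toFun q := ((1 : R) ⊗ₜ[k] degT k) • q
  map_add' := smul_add _
  map_smul' x q := by
    simp only [RingHom.id_apply, ← mul_smul, degT_central]

/-- The `R`-module structure on an `R ⊗[k] V`-module obtained by restriction of scalars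
along `R → R ⊗[k] V`. -/
def rRestrict (Q : Type) [AddCommGroup Q] [Module (R ⊗[k] DegV k) Q] : Module R Q :=
  Module.compHom Q (Algebra.TensorProduct.includeLeftRingHom : R →+* R ⊗[k] DegV k)

/-- The `V`-module structure on an `R ⊗[k] V`-module obtained by restriction of scalars
along `V → R ⊗[k] V`. -/
def vRestrict (Q : Type) [AddCommGroup Q] [Module (R ⊗[k] DegV k) Q] : Module (DegV k) Q :=
  Module.compHom Q
    ((Algebra.TensorProduct.includeRight : DegV k →ₐ[k] R ⊗[k] DegV k) : DegV k →+* R ⊗[k] DegV k)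

/-- The action of `r : R` on an `R ⊗[k] V`-module `Q`, as a `V`-linear endomorphism of `Q`. -/
def rAct (Q : Type) [AddCommGroup Q] [Module (R ⊗[k] DegV k) Q] (r : R) :
    letI := vRestrict k R Q
    Q →ₗ[DegV k] Q :=
  letI := vRestrict k R Q
  { toFun := fun q => (r ⊗ₜ[k] (1 : DegV k)) • q
    map_add' := smul_add _
    map_smul' := fun v q => by
      show (r ⊗ₜ[k] (1 : DegV k)) • (((1 : R) ⊗ₜ[k] v) • q)
        = ((1 : R) ⊗ₜ[k] v) • ((r ⊗ₜ[k] (1 : DegV k)) • q)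
      rw [← mul_smul, ← mul_smul, Algebra.TensorProduct.tmul_mul_tmul,
        Algebra.TensorProduct.tmul_mul_tmul, one_mul, mul_one, one_mul, mul_one] }

/-- The action of `r : R` on a module `M`, as a `k`-linear endomorphism of `M`
(where `M` is viewed as a `k`-module by restriction of scalars along `k → R`). -/
def rActK (M : Type) [AddCommGroup M] [Module R M] (r : R) :
    letI := Module.compHom M (algebraMap k R)
    M →ₗ[k] M :=
  letI := Module.compHom M (algebraMap k R)
  { toFun := fun m => r • m
    map_add' := smul_add r
    map_smul' := fun c m => by
      show r • ((algebraMap k R c) • m) = (algebraMap k R c) • (r • m)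
      rw [← mul_smul, ← mul_smul, Algebra.commutes] }

/-- Degeneration of modules (Yoshino): `M ⇒_deg N` iff there is a finitely generated
`R ⊗[k] V`-module `Q`, flat over `V`, with `Q/tQ ≅ N` as `R`-modules and
`Q_t = Q[t⁻¹] ≅ M ⊗[k] K` compatibly with the `R`- and `K`-actions
(i.e. as `R ⊗[k] K`-modules). -/
def Degenerates (M N : Type) [AddCommGroup M] [Module R M] [AddCommGroup N] [Module R N] :
    Prop :=
  ∃ (Q : Type) (_ : AddCommGroup Q) (_ : Module (R ⊗[k] DegV k) Q),
    Module.Finite (R ⊗[k] DegV k) Q ∧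
    (letI := vRestrict k R Q; Module.Flat (DegV k) Q) ∧
    -- `Q/tQ ≅ N` as `R`-modules
    (letI := rRestrict k R (Q ⧸ LinearMap.range (tSmul k R Q))
     Nonempty ((Q ⧸ LinearMap.range (tSmul k R Q)) ≃ₗ[R] N)) ∧
    -- `Q_t ≅ M ⊗_k K` as `R ⊗_k K`-modules, i.e. compatibly with both actions
    (letI := vRestrict k R Q
     letI : Module k M := Module.compHom M (algebraMap k R)
     ∃ f : LocalizedModule (Submonoid.powers (degT k)) Q ≃+ (M ⊗[k] DegK k),
       (∀ (c : DegK k) (x : LocalizedModule (Submonoid.powers (degT k)) Q),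
          f (c • x) = LinearMap.lTensor M (LinearMap.mulLeft k c) (f x)) ∧
       (∀ (r : R) (x : LocalizedModule (Submonoid.powers (degT k)) Q),
          f (LocalizedModule.map (Submonoid.powers (degT k)) (rAct k R Q r) x)
            = LinearMap.rTensor (DegK k) (rActK k R M r) (f x)))

end

/-- The ring `S = k[[x,y,u,v]]/(x²y + u² + v²)`. -/
abbrev DinfRing3 (k : Type) [Field k] : Type :=
  MvPowerSeries (Fin 4) k ⧸
    Ideal.span {(MvPowerSeries.X (0 : Fin 4) : MvPowerSeries (Fin 4) k) ^ 2 * (MvPowerSeries.X (1 : Fin 4) : MvPowerSeries (Fin 4) k) +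
      (MvPowerSeries.X (2 : Fin 4) : MvPowerSeries (Fin 4) k) ^ 2 + (MvPowerSeries.X (3 : Fin 4) : MvPowerSeries (Fin 4) k) ^ 2}

/-- The residue class of `x` in `S`. -/
def sx (k : Type) [Field k] : DinfRing3 k := Ideal.Quotient.mk _ ((MvPowerSeries.X (0 : Fin 4) : MvPowerSeries (Fin 4) k))

/-- The residue class of `y` in `S`. -/
def sy (k : Type) [Field k] : DinfRing3 k := Ideal.Quotient.mk _ ((MvPowerSeries.X (1 : Fin 4) : MvPowerSeries (Fin 4) k))

/-- The residue class of `u` in `S`. -/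
def su (k : Type) [Field k] : DinfRing3 k := Ideal.Quotient.mk _ ((MvPowerSeries.X (2 : Fin 4) : MvPowerSeries (Fin 4) k))

/-- The residue class of `v` in `S`. -/
def sv (k : Type) [Field k] : DinfRing3 k := Ideal.Quotient.mk _ ((MvPowerSeries.X (3 : Fin 4) : MvPowerSeries (Fin 4) k))

/-- The matrix `φₙ = [[x, yⁿ],[0, -x]]` over `S`. -/
def phi (k : Type) [Field k] (n : ℕ) : Matrix (Fin 2) (Fin 2) (DinfRing3 k) :=
  !![sx k, sy k ^ n; 0, -sx k]

/-- The matrix `ψₙ = [[xy, yⁿ⁺¹],[0, -xy]]` over `S`. -/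
def psi (k : Type) [Field k] (n : ℕ) : Matrix (Fin 2) (Fin 2) (DinfRing3 k) :=
  !![sx k * sy k, sy k ^ (n + 1); 0, -(sx k * sy k)]

/-- The 4×4 block matrix `φₙ^{##} = [[φₙ, (u+iv)·1₂],[(-u+iv)·1₂, ψₙ]]` over `S`. -/
def phiSharp (k : Type) [Field k] (i : k) (n : ℕ) :
    Matrix (Fin 2 ⊕ Fin 2) (Fin 2 ⊕ Fin 2) (DinfRing3 k) :=
  Matrix.fromBlocks (phi k n)
    ((su k + algebraMap k (DinfRing3 k) i * sv k) • (1 : Matrix (Fin 2) (Fin 2) (DinfRing3 k)))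
    ((-su k + algebraMap k (DinfRing3 k) i * sv k) • (1 : Matrix (Fin 2) (Fin 2) (DinfRing3 k)))
    (psi k n)

/-- `Nₙ = coker φₙ^{##}` over `S`. -/
abbrev Nmod (k : Type) [Field k] (i : k) (n : ℕ) : Type :=
  ((Fin 2 ⊕ Fin 2) → DinfRing3 k) ⧸ LinearMap.range (Matrix.toLin' (phiSharp k i n))


theorem tensor_pi_coker {k R K M ι : Type} [Field k] [CommRing R] [Algebra k R] [CommRing K] [Algebra k K]
    [AddCommGroup M] [Module R M] [Module k M] [IsScalarTower k R M] [Fintype ι] [DecidableEq ι]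
    (Φ : Matrix ι ι R) (π : (ι → R) →ₗ[R] M) (hπ : Function.Surjective π)
    (hk : LinearMap.ker π = LinearMap.range (Matrix.toLin' Φ)) :
    ∃ β : (ι → R ⊗[k] K) →+ M ⊗[k] K, Function.Surjective β ∧
      (∀ z, β z = 0 ↔ ∃ w, z =
        (Φ.map (Algebra.TensorProduct.includeLeftRingHom : R →+* R ⊗[k] K)).mulVec w) ∧
      (∀ (c : K) z, β (((1 : R) ⊗ₜ[k] c) • z) = LinearMap.lTensor M (LinearMap.mulLeft k c) (β z)) ∧
      (∀ (r : R) z (g : M →ₗ[k] M), (∀ m, g m = r • m) →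
        β ((r ⊗ₜ[k] (1 : K)) • z) = LinearMap.rTensor K g (β z)) := by
  let E : (ι → R) ⊗[k] K ≃ₗ[k] (ι → R ⊗[k] K) := TensorProduct.piLeft k K (fun _ : ι => R)
  have hE : ∀ a c, E (a ⊗ₜ c) = fun j => a j ⊗ₜ c := fun a c => by
    ext j; simp [E]
  let π' : (ι → R) →ₗ[k] M := π.restrictScalars k
  let F : (ι → R) →ₗ[k] (ι → R) := (Matrix.toLin' Φ).restrictScalars k
  have hex : Function.Exact F π' := by
    intro x
    have : x ∈ LinearMap.ker π ↔ x ∈ LinearMap.range (Matrix.toLin' Φ) := by rw [hk]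
    have h1 : π' x = 0 ↔ π x = 0 := Iff.rfl
    have h2 : x ∈ Set.range F ↔ x ∈ LinearMap.range (Matrix.toLin' Φ) := Iff.rfl
    rw [h1, h2, ← this, LinearMap.mem_ker]
  have hex2 := rTensor_exact K hex hπ
  have hF : ∀ y, E (F.rTensor K y) =
      (Φ.map (Algebra.TensorProduct.includeLeftRingHom : R →+* R ⊗[k] K)).mulVec (E y) := by
    intro y
    induction y with
    | zero => simp
    | add a b ha hb => simp only [map_add, ha, hb, Matrix.mulVec_add]
    | tmul a c =>
      rw [LinearMap.rTensor_tmul, hE, hE]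
      ext j
      have : F a j = ∑ l, Φ j l * a l := by simp [F, Matrix.mulVec, dotProduct]
      rw [this, TensorProduct.sum_tmul]
      simp [Matrix.mulVec, dotProduct]
  refine ⟨((π'.rTensor K).comp E.symm.toLinearMap).toAddMonoidHom, ?_, ?_, ?_, ?_⟩
  · exact (LinearMap.rTensor_surjective K (g := π') hπ).comp E.symm.surjective
  · intro z
    obtain ⟨y, rfl⟩ := E.surjective z
    have := hex2 y
    simp only [LinearMap.toAddMonoidHom_coe, LinearMap.comp_apply, LinearEquiv.coe_coe, LinearEquiv.symm_apply_apply]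
    rw [this]
    constructor
    · rintro ⟨w, rfl⟩
      exact ⟨E w, hF w⟩
    · rintro ⟨w, hw⟩
      obtain ⟨w, rfl⟩ := E.surjective w
      rw [← hF] at hw
      exact ⟨w, (E.injective hw).symm⟩
  · intro c z
    obtain ⟨y, rfl⟩ := E.surjective z
    simp only [LinearMap.toAddMonoidHom_coe, LinearMap.comp_apply, LinearEquiv.coe_coe, LinearEquiv.symm_apply_apply]
    have : ((1 : R) ⊗ₜ[k] c) • E y = E (LinearMap.lTensor _ (LinearMap.mulLeft k c) y) := by
      induction y with
      | zero => simp
      | add a b ha hb => simp only [map_add, ha, hb, smul_add]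
      | tmul a d =>
        rw [LinearMap.lTensor_tmul, hE, hE]
        ext j
        simp
    rw [this, LinearEquiv.symm_apply_apply]
    clear this
    induction y with
    | zero => simp
    | add a b ha hb => simp only [map_add, ha, hb]
    | tmul a d => simp
  · intro r z g hg
    obtain ⟨y, rfl⟩ := E.surjective z
    simp only [LinearMap.toAddMonoidHom_coe, LinearMap.comp_apply, LinearEquiv.coe_coe, LinearEquiv.symm_apply_apply]
    have : (r ⊗ₜ[k] (1 : K)) • E y = E (LinearMap.rTensor K ((LinearMap.lsmul R (ι → R) r).restrictScalars k) y) := by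
      induction y with
      | zero => simp
      | add a b ha hb => simp only [map_add, ha, hb, smul_add]
      | tmul a d =>
        rw [LinearMap.rTensor_tmul, hE, hE]
        ext j
        simp
    rw [this, LinearEquiv.symm_apply_apply]
    clear this
    induction y with
    | zero => simp
    | add a b ha hb => simp only [map_add, ha, hb]
    | tmul a d => simp [hg, π']

theorem loc_part {k Q W : Type} [Field k] [AddCommGroup Q] [Module (DegV k) Q] [AddCommGroup W]
    (ρ : DegK k →+* AddMonoid.End W) (h : Q →+ W)
    (hV : ∀ (v : DegV k) q, h (v • q) = ρ (algebraMap _ _ v) (h q))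
    (hs : ∀ w, ∃ (m : ℕ) (q : Q), ρ (algebraMap _ _ (degT k ^ m)) w = h q)
    (hinj : ∀ q, h q = 0 → ∃ m : ℕ, degT k ^ m • q = 0) :
    ∃ f : LocalizedModule (Submonoid.powers (degT k)) Q ≃+ W,
      (∀ (c : DegK k) x, f (c • x) = ρ c (f x)) ∧
      (∀ (a : Q →ₗ[DegV k] Q) (b : W →+ W), (∀ q, h (a q) = b (h q)) →
        (∀ c w, b (ρ c w) = ρ c (b w)) →
        ∀ x, f (LocalizedModule.map (Submonoid.powers (degT k)) a x) = b (f x)) := by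
  let _ : Module (Localization (Submonoid.powers (degT k))) W := Module.compHom W ρ
  have hK : ∀ (c : Localization (Submonoid.powers (degT k))) (w : W), c • w = ρ c w := fun _ _ => rfl
  let _ : Module (DegV k) W := Module.compHom W (algebraMap (DegV k) (Localization (Submonoid.powers (degT k))))
  have hVW : ∀ (c : DegV k) (w : W), c • w = ρ (algebraMap _ _ c) w := fun _ _ => rfl
  have : IsScalarTower (DegV k) (Localization (Submonoid.powers (degT k))) W :=
    IsScalarTower.of_algebraMap_smul fun _ _ => rfl
  let h' : Q →ₗ[DegV k] W := { h with map_smul' := fun v q => hV v q }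
  have : IsLocalizedModule (Submonoid.powers (degT k)) h' := by
    refine ⟨?_, ?_, ?_⟩
    · intro x
      have h1 : IsUnit (algebraMap (DegV k) (Localization (Submonoid.powers (degT k))) x) :=
        IsLocalization.map_units _ x
      rw [Module.End.isUnit_iff]
      obtain ⟨u, hu⟩ := h1
      have key : ∀ w : W, (algebraMap (DegV k) (Module.End (DegV k) W) x) w = u • w := by
        intro w
        rw [Module.algebraMap_end_apply, ← algebraMap_smul (Localization (Submonoid.powers (degT k))), ← hu]
        rfl
      constructor
      · intro a b hab
        rw [key, key] at hab
        exact smul_left_cancel u hab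
      · intro w
        exact ⟨u⁻¹ • w, by rw [key, smul_inv_smul]⟩
    · intro y
      obtain ⟨m, q, hq⟩ := hs y
      exact ⟨(q, ⟨degT k ^ m, m, rfl⟩), hq⟩
    · intro a b hab
      obtain ⟨m, hm⟩ := hinj (a - b) (by rw [map_sub]; exact sub_eq_zero.mpr hab)
      refine ⟨⟨degT k ^ m, m, rfl⟩, ?_⟩
      rw [smul_sub] at hm
      exact sub_eq_zero.mp hm
  let f := IsLocalizedModule.iso (Submonoid.powers (degT k)) h'
  have hf : ∀ (c : Localization (Submonoid.powers (degT k))) x, f (c • x) = c • f x := 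
    fun c x => (f.toLinearMap.extendScalarsOfIsLocalization (Submonoid.powers (degT k)) (Localization (Submonoid.powers (degT k)))).map_smul c x
  refine ⟨f.toAddEquiv, hf, ?_⟩
  intro a b hab hb x
  let b' : W →ₗ[DegV k] W := { b with map_smul' := fun v q => hb _ _ }
  have : f.toLinearMap ∘ₗ ((LocalizedModule.map (Submonoid.powers (degT k)) a).restrictScalars (DegV k)) = b' ∘ₗ f.toLinearMap := by
    apply IsLocalizedModule.linearMap_ext (Submonoid.powers (degT k)) (LocalizedModule.mkLinearMap _ Q) h'
    ext q
    have e1 : LocalizedModule.map (Submonoid.powers (degT k)) a (LocalizedModule.mk q 1) = LocalizedModule.mk (a q) 1 := by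
      simp
    have e2 : ∀ q, f (LocalizedModule.mk q 1) = h q := fun q =>
      IsLocalizedModule.iso_mk_one (Submonoid.powers (degT k)) h' q
    change f (LocalizedModule.map (Submonoid.powers (degT k)) a (LocalizedModule.mk q 1)) =
      b (f (LocalizedModule.mk q 1))
    rw [e1, e2, e2, hab]
  exact LinearMap.congr_fun this x


instance degV_loc (k : Type) [Field k] : IsLocalization.AtPrime (DegV k) (tIdeal k) :=
  inferInstanceAs (IsLocalization.AtPrime (Localization.AtPrime (tIdeal k)) (tIdeal k))

instance degV_domain (k : Type) [Field k] : IsDomain (DegV k) :=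
  inferInstanceAs (IsDomain (Localization.AtPrime (tIdeal k)))

theorem tIdeal_ne_bot (k : Type) [Field k] : tIdeal k ≠ ⊥ := by
  simp [tIdeal]

instance degV_dvr (k : Type) [Field k] : IsDiscreteValuationRing (DegV k) :=
  IsLocalization.AtPrime.isDiscreteValuationRing_of_dedekind_domain (Polynomial k) (tIdeal_ne_bot k) (DegV k)

instance degK_loc (k : Type) [Field k] : IsLocalization (Submonoid.powers (degT k)) (DegK k) :=
  inferInstanceAs (IsLocalization (Submonoid.powers (degT k)) (Localization (Submonoid.powers (degT k))))

instance degK_tower (k : Type) [Field k] : IsScalarTower k (DegV k) (DegK k) :=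
  inferInstanceAs (IsScalarTower k (DegV k) (Localization (Submonoid.powers (degT k))))

theorem degT_irreducible (k : Type) [Field k] : Irreducible (degT k) := by
  rw [IsDiscreteValuationRing.irreducible_iff_uniformizer,
    ← IsLocalization.AtPrime.map_eq_maximalIdeal (tIdeal k) (DegV k), tIdeal, Ideal.map_span]
  simp [degT]

def vEval (k : Type) [Field k] : DegV k →ₐ[k] k :=
  IsLocalization.liftAlgHom (M := (tIdeal k).primeCompl) (f := (Polynomial.aeval (0 : k) : k[X] →ₐ[k] k)) (by
    intro y
    have hy : (y : k[X]) ∉ tIdeal k := y.2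
    rw [isUnit_iff_ne_zero]
    intro h
    apply hy
    change (y : k[X]) ∈ Ideal.span {X}
    rw [Ideal.mem_span_singleton, Polynomial.X_dvd_iff, Polynomial.coeff_zero_eq_aeval_zero]
    simpa using h)

theorem vEval_algebraMap (k : Type) [Field k] (p : k[X]) : vEval k (algebraMap _ _ p) = p.eval 0 := by
  have := IsLocalization.lift_eq (M := (tIdeal k).primeCompl) (S := DegV k) (g := ((Polynomial.aeval (0 : k) : k[X] →ₐ[k] k) : k[X] →+* k)) (by
    intro y
    have hy : (y : k[X]) ∉ tIdeal k := y.2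
    rw [isUnit_iff_ne_zero]
    intro h
    apply hy
    change (y : k[X]) ∈ Ideal.span {X}
    rw [Ideal.mem_span_singleton, Polynomial.X_dvd_iff, Polynomial.coeff_zero_eq_aeval_zero]
    simpa using h) p
  rw [← Polynomial.coe_aeval_eq_eval]
  exact this

theorem vEval_degT (k : Type) [Field k] : vEval k (degT k) = 0 := by
  simp [degT, vEval_algebraMap]

theorem vEval_decomp {k : Type} [Field k] (v : DegV k) :
    ∃ w, v = algebraMap k _ (vEval k v) + degT k * w := by
  have key : ∀ v : DegV k, vEval k v = 0 → ∃ w, v = degT k * w := by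
    intro v hv
    obtain ⟨p, s, rfl⟩ := IsLocalization.exists_mk'_eq (tIdeal k).primeCompl v
    have h1 : IsLocalization.mk' (DegV k) p s * algebraMap _ _ (s : k[X]) = algebraMap _ _ p :=
      IsLocalization.mk'_spec _ _ _
    have h2 : p.eval 0 = 0 := by
      rw [← vEval_algebraMap, ← h1, map_mul, hv, zero_mul]
    have h3 : X ∣ p := by
      rw [Polynomial.X_dvd_iff, Polynomial.coeff_zero_eq_eval_zero, h2]
    obtain ⟨q, rfl⟩ := h3
    refine ⟨IsLocalization.mk' _ q s, ?_⟩
    rw [degT, IsLocalization.mul_mk'_eq_mk'_of_mul]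
  obtain ⟨w, hw⟩ := key (v - algebraMap k _ (vEval k v)) (by simp)
  exact ⟨w, by rw [← hw]; ring⟩

section
variable (k R : Type) [Field k] [CommRing R] [Algebra k R]

def tA : R ⊗[k] DegV k := (1 : R) ⊗ₜ degT k

def epsA : R ⊗[k] DegV k →ₐ[k] R :=
  Algebra.TensorProduct.productMap (AlgHom.id k R) ((Algebra.ofId k R).comp (vEval k))

theorem epsA_tmul (r : R) (v : DegV k) : epsA k R (r ⊗ₜ v) = r * algebraMap k R (vEval k v) := by
  rw [epsA, Algebra.TensorProduct.productMap_apply_tmul]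
  rfl

theorem epsA_left (r : R) : epsA k R (r ⊗ₜ 1) = r := by
  simp [epsA_tmul]

theorem epsA_t : epsA k R (tA k R) = 0 := by
  simp [epsA_tmul, tA, vEval_degT]

theorem epsA_decomp (x : R ⊗[k] DegV k) : ∃ y, x = (epsA k R x) ⊗ₜ 1 + tA k R * y := by
  induction x with
  | zero => exact ⟨0, by simp⟩
  | add a b ha hb =>
    obtain ⟨y, hy⟩ := ha
    obtain ⟨z, hz⟩ := hb
    refine ⟨y + z, ?_⟩
    rw [map_add, TensorProduct.add_tmul, mul_add]
    nth_rewrite 1 [hy, hz]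
    ring
  | tmul r v =>
    obtain ⟨w, hw⟩ := vEval_decomp v
    refine ⟨r ⊗ₜ w, ?_⟩
    rw [epsA_tmul, tA, Algebra.TensorProduct.tmul_mul_tmul, one_mul]
    nth_rewrite 1 [hw]
    rw [TensorProduct.tmul_add]
    congr 1
    rw [Algebra.algebraMap_eq_smul_one, Algebra.algebraMap_eq_smul_one, mul_smul_comm, mul_one,
      TensorProduct.smul_tmul]

theorem tA_regular (x : R ⊗[k] DegV k) (h : tA k R * x = 0) : x = 0 := by
  have h1 : Function.Injective (LinearMap.mulLeft k (degT k)) := by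
    intro a b hab
    exact mul_left_cancel₀ (degT_irreducible k).ne_zero hab
  have h2 := Module.Flat.lTensor_preserves_injective_linearMap (M := R) _ h1
  have h3 : ∀ x, LinearMap.lTensor R (LinearMap.mulLeft k (degT k)) x = tA k R * x := by
    intro x
    induction x with
    | zero => simp
    | add a b ha hb => simp only [map_add, ha, hb, mul_add]
    | tmul r v => simp [tA]
  apply h2
  rw [h3, h, map_zero]

def vToK : DegV k →ₐ[k] DegK k := IsScalarTower.toAlgHom k (DegV k) (DegK k)

def gK : R ⊗[k] DegV k →ₐ[k] R ⊗[k] DegK k :=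
  Algebra.TensorProduct.map (AlgHom.id k R) (vToK k)

theorem gK_tmul (r : R) (v : DegV k) : gK k R (r ⊗ₜ v) = r ⊗ₜ algebraMap _ _ v := by
  simp [gK, vToK]

theorem gK_injective : Function.Injective (gK k R) := by
  have h1 : Function.Injective (vToK k).toLinearMap :=
    IsLocalization.injective (DegK k) (powers_le_nonZeroDivisors_of_noZeroDivisors (degT_irreducible k).ne_zero)
  have h2 := Module.Flat.lTensor_preserves_injective_linearMap (M := R) _ h1
  exact h2

theorem gK_surj (x : R ⊗[k] DegK k) : ∃ (m : ℕ) (y : R ⊗[k] DegV k), gK k R (tA k R ^ m) * x = gK k R y := by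
  induction x with
  | zero => exact ⟨0, 0, by simp⟩
  | add a b ha hb =>
    obtain ⟨m, y, hy⟩ := ha
    obtain ⟨l, z, hz⟩ := hb
    refine ⟨m + l, tA k R ^ l * y + tA k R ^ m * z, ?_⟩
    rw [pow_add, map_mul, map_add, map_mul, map_mul, ← hy, ← hz]
    ring
  | tmul r c =>
    obtain ⟨v, ⟨_, m, rfl⟩, rfl⟩ := IsLocalization.exists_mk'_eq (Submonoid.powers (degT k)) c
    refine ⟨m, r ⊗ₜ v, ?_⟩
    rw [tA, Algebra.TensorProduct.tmul_pow, gK_tmul, gK_tmul, Algebra.TensorProduct.tmul_mul_tmul,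
      one_pow, one_mul]
    congr 1
    exact IsLocalization.mk'_spec' (DegK k) v (⟨degT k ^ m, m, rfl⟩ : Submonoid.powers (degT k))

theorem gK_surj_pi {ι : Type} [Fintype ι] (x : ι → R ⊗[k] DegK k) :
    ∃ (m : ℕ) (y : ι → R ⊗[k] DegV k), gK k R (tA k R ^ m) • x = fun j => gK k R (y j) := by
  choose m y hy using fun j => gK_surj k R (x j)
  refine ⟨∑ j, m j, fun j => tA k R ^ (∑ l, m l - m j) * y j, ?_⟩
  ext j
  have : m j ≤ ∑ l, m l := Finset.single_le_sum (f := m) (fun _ _ => Nat.zero_le _) (Finset.mem_univ j)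
  rw [map_mul, ← hy, Pi.smul_apply, smul_eq_mul, ← mul_assoc, ← map_mul, ← pow_add, Nat.sub_add_cancel this]

end


theorem exists_quot_lift {A X W : Type} [Ring A] [AddCommGroup X] [Module A X] [AddCommGroup W]
    (p : Submodule A X) (φ : X →+ W) (h : ∀ x ∈ p, φ x = 0) :
    ∃ g : X ⧸ p →+ W, ∀ x, g (p.mkQ x) = φ x :=
  ⟨QuotientAddGroup.lift p.toAddSubgroup φ h, fun _ => rfl⟩

/-- The action of `K` on `M ⊗ K`. -/
def rhoK {k K M : Type} [Field k] [CommRing K] [Algebra k K] [AddCommGroup M] [Module k M] :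
    K →+* AddMonoid.End (M ⊗[k] K) where
  toFun c := (LinearMap.lTensor M (LinearMap.mulLeft k c)).toAddMonoidHom
  map_one' := by
    refine AddMonoidHom.ext fun x => ?_
    change LinearMap.lTensor M (LinearMap.mulLeft k 1) x = x
    simp
  map_mul' a b := by
    refine AddMonoidHom.ext fun x => ?_
    change LinearMap.lTensor M (LinearMap.mulLeft k (a * b)) x =
      LinearMap.lTensor M (LinearMap.mulLeft k a) (LinearMap.lTensor M (LinearMap.mulLeft k b) x)
    rw [LinearMap.mulLeft_mul, LinearMap.lTensor_comp_apply]
  map_zero' := by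
    refine AddMonoidHom.ext fun x => ?_
    change LinearMap.lTensor M (LinearMap.mulLeft k 0) x = 0
    simp
  map_add' a b := by
    refine AddMonoidHom.ext fun x => ?_
    have : LinearMap.mulLeft k (a + b) = LinearMap.mulLeft k a + LinearMap.mulLeft k b := by
      ext; simp [add_mul]
    change LinearMap.lTensor M (LinearMap.mulLeft k (a + b)) x =
      LinearMap.lTensor M (LinearMap.mulLeft k a) x + LinearMap.lTensor M (LinearMap.mulLeft k b) x
    rw [this, LinearMap.lTensor_add, LinearMap.add_apply]

section
variable {k R ι : Type} [Field k] [CommRing R] [Algebra k R] [Fintype ι] [DecidableEq ι]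

abbrev cokQ (Φ : Matrix ι ι (R ⊗[k] DegV k)) : Type :=
  (ι → R ⊗[k] DegV k) ⧸ LinearMap.range (Matrix.toLin' Φ)

theorem cokQ_t_regular (Φ Ψ : Matrix ι ι (R ⊗[k] DegV k)) (ΦN : Matrix ι ι R)
    (hΦΨ : Φ * Ψ = 0) (hΦN : Φ.map (epsA k R) = ΦN)
    (hex : ∀ z, ΦN.mulVec z = 0 → ∃ w, z = (Ψ.map (epsA k R)).mulVec w)
    (q : cokQ Φ) (hq : tA k R • q = 0) : q = 0 := by
  obtain ⟨q, rfl⟩ := Submodule.mkQ_surjective _ q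
  rw [← map_smul, Submodule.mkQ_apply, Submodule.Quotient.mk_eq_zero] at hq
  obtain ⟨z, hz⟩ := hq
  rw [Matrix.toLin'_apply] at hz
  have heps : ∀ (B : Matrix ι ι (R ⊗[k] DegV k)) (x : ι → R ⊗[k] DegV k),
      (fun j => epsA k R (B.mulVec x j)) = (B.map (epsA k R)).mulVec (fun j => epsA k R (x j)) := by
    intro B x
    ext j
    simp [Matrix.mulVec, dotProduct]
  have h1 : ΦN.mulVec (fun j => epsA k R (z j)) = 0 := by
    rw [← hΦN, ← heps, hz]
    ext j
    simp [epsA_t]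
  obtain ⟨w, hw⟩ := hex _ h1
  choose y hy using fun j => epsA_decomp k R (z j - Ψ.mulVec (fun l => w l ⊗ₜ 1) j)
  have h2 : z = Ψ.mulVec (fun l => w l ⊗ₜ 1) + tA k R • y := by
    ext j
    have h3 : epsA k R (z j - Ψ.mulVec (fun l => w l ⊗ₜ 1) j) = 0 := by
      rw [map_sub, congrFun (heps Ψ _) j, congrFun hw j]
      simp only [epsA_left, sub_self]
    have h4 := hy j
    rw [h3, TensorProduct.zero_tmul, zero_add] at h4
    rw [Pi.add_apply, Pi.smul_apply, smul_eq_mul, ← h4]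
    ring
  rw [h2, Matrix.mulVec_add, Matrix.mulVec_mulVec, hΦΨ, Matrix.zero_mulVec, zero_add,
    Matrix.mulVec_smul] at hz
  rw [Submodule.mkQ_apply, Submodule.Quotient.mk_eq_zero]
  refine ⟨y, ?_⟩
  rw [Matrix.toLin'_apply]
  ext j
  have h5 := congrFun hz j
  rw [Pi.smul_apply, Pi.smul_apply, smul_eq_mul, smul_eq_mul] at h5
  exact sub_eq_zero.mp (tA_regular k R _ (by rw [mul_sub, h5, sub_self]))

theorem flat_of_t_regular {Q : Type} [AddCommGroup Q] [Module (DegV k) Q]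
    (h : ∀ q : Q, degT k • q = 0 → q = 0) : Module.Flat (DegV k) Q := by
  rw [IsDedekindDomain.flat_iff_torsion_eq_bot, ← Submodule.isTorsionFree_iff_torsion_eq_bot]
  have key : ∀ (a : DegV k) (q : Q), a ≠ 0 → a • q = 0 → q = 0 := by
    intro a q ha hq
    obtain ⟨n, u, rfl⟩ := IsDiscreteValuationRing.eq_unit_mul_pow_irreducible ha (degT_irreducible k)
    rw [mul_smul] at hq
    replace hq : degT k ^ n • q = 0 := (smul_eq_zero_iff_eq u).mp hq
    clear ha
    induction n with
    | zero => simpa using hq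
    | succ n ih =>
      rw [pow_succ', mul_smul] at hq
      exact ih (h _ hq)
  refine ⟨fun a ha x y hxy => ?_⟩
  have := key a (x - y) ha.ne_zero (by rw [smul_sub]; exact sub_eq_zero.mpr hxy)
  exact sub_eq_zero.mp this

/-- reduction mod t -/
theorem cokQ_mod_t (Φ : Matrix ι ι (R ⊗[k] DegV k)) (ΦN : Matrix ι ι R)
    (hΦN : Φ.map (epsA k R) = ΦN) :
    letI := rRestrict k R ((cokQ Φ) ⧸ LinearMap.range (tSmul k R (cokQ Φ)))
    Nonempty (((cokQ Φ) ⧸ LinearMap.range (tSmul k R (cokQ Φ))) ≃ₗ[R]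
      ((ι → R) ⧸ LinearMap.range (Matrix.toLin' ΦN))) := by
  let inst := rRestrict k R ((cokQ Φ) ⧸ LinearMap.range (tSmul k R (cokQ Φ)))
  have heps : ∀ (B : Matrix ι ι (R ⊗[k] DegV k)) (x : ι → R ⊗[k] DegV k),
      (fun j => epsA k R (B.mulVec x j)) = (B.map (epsA k R)).mulVec (fun j => epsA k R (x j)) := by
    intro B x
    ext j
    simp [Matrix.mulVec, dotProduct]
  let e0 : (ι → R ⊗[k] DegV k) →ₛₗ[(epsA k R : R ⊗[k] DegV k →+* R)] (ι → R) :=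
    { toFun := fun x j => epsA k R (x j)
      map_add' := fun x y => by ext j; simp
      map_smul' := fun a x => by ext j; simp }
  let e1 : (ι → R ⊗[k] DegV k) →ₛₗ[(epsA k R : R ⊗[k] DegV k →+* R)]
      ((ι → R) ⧸ LinearMap.range (Matrix.toLin' ΦN)) :=
    (Submodule.mkQ (LinearMap.range (Matrix.toLin' ΦN))).comp e0
  let e2 := Submodule.liftQ (LinearMap.range (Matrix.toLin' Φ)) e1 (by
    rintro _ ⟨z, rfl⟩
    rw [LinearMap.mem_ker, Matrix.toLin'_apply]
    change Submodule.mkQ _ (fun j => epsA k R (Φ.mulVec z j)) = 0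
    rw [heps, hΦN, Submodule.mkQ_apply, Submodule.Quotient.mk_eq_zero]
    exact ⟨_, rfl⟩)
  let e3 := Submodule.liftQ (LinearMap.range (tSmul k R (cokQ Φ))) e2 (by
    rintro _ ⟨z, rfl⟩
    rw [LinearMap.mem_ker]
    change e2 (tA k R • z) = 0
    rw [LinearMap.map_smulₛₗ]
    change epsA k R (tA k R) • e2 z = 0
    rw [epsA_t, zero_smul])
  have he3 : ∀ x, e3 (Submodule.mkQ _ (Submodule.mkQ _ x)) = Submodule.mkQ _ (fun j => epsA k R (x j)) :=
    fun x => rfl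
  let e4 : ((cokQ Φ) ⧸ LinearMap.range (tSmul k R (cokQ Φ))) →ₗ[R]
      ((ι → R) ⧸ LinearMap.range (Matrix.toLin' ΦN)) :=
    { toFun := e3
      map_add' := e3.map_add
      map_smul' := fun r x => by
        change e3 ((r ⊗ₜ[k] (1 : DegV k)) • x) = r • e3 x
        rw [LinearMap.map_smulₛₗ]
        change epsA k R (r ⊗ₜ[k] (1 : DegV k)) • e3 x = r • e3 x
        rw [epsA_left] }
  refine ⟨LinearEquiv.ofBijective e4 ⟨?_, ?_⟩⟩
  · rw [injective_iff_map_eq_zero]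
    intro x hx
    change e3 x = 0 at hx
    obtain ⟨x, rfl⟩ := Submodule.mkQ_surjective _ x
    obtain ⟨x, rfl⟩ := Submodule.mkQ_surjective _ x
    rw [he3, Submodule.mkQ_apply, Submodule.Quotient.mk_eq_zero] at hx
    obtain ⟨w, hw⟩ := hx
    rw [Matrix.toLin'_apply] at hw
    choose y hy using fun j => epsA_decomp k R (x j - Φ.mulVec (fun l => w l ⊗ₜ 1) j)
    have h2 : x = Φ.mulVec (fun l => w l ⊗ₜ 1) + tA k R • y := by
      ext j
      have h3 : epsA k R (x j - Φ.mulVec (fun l => w l ⊗ₜ 1) j) = 0 := by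
        rw [map_sub, congrFun (heps Φ _) j, hΦN, ← congrFun hw j]
        simp only [epsA_left, sub_self]
      have h4 := hy j
      rw [h3, TensorProduct.zero_tmul, zero_add] at h4
      rw [Pi.add_apply, Pi.smul_apply, smul_eq_mul, ← h4]
      ring
    rw [Submodule.mkQ_apply, Submodule.Quotient.mk_eq_zero]
    refine ⟨Submodule.mkQ _ y, ?_⟩
    change tA k R • Submodule.mkQ (LinearMap.range (Matrix.toLin' Φ)) y =
      Submodule.mkQ (LinearMap.range (Matrix.toLin' Φ)) x
    rw [h2, map_add, ← map_smul]
    have : (Submodule.mkQ (LinearMap.range (Matrix.toLin' Φ))) (Φ.mulVec (fun l => w l ⊗ₜ 1)) = 0 := by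
      rw [Submodule.mkQ_apply, Submodule.Quotient.mk_eq_zero]
      exact ⟨_, rfl⟩
    rw [this, zero_add]
  · intro y
    obtain ⟨y, rfl⟩ := Submodule.mkQ_surjective _ y
    refine ⟨Submodule.mkQ _ (Submodule.mkQ _ (fun j => y j ⊗ₜ 1)), ?_⟩
    change e3 _ = _
    rw [he3]
    simp only [epsA_left]

set_option maxHeartbeats 2000000 in
theorem cokQ_loc {M : Type} [AddCommGroup M] [Module R M] [Module k M] [IsScalarTower k R M]
    (Φ : Matrix ι ι (R ⊗[k] DegV k)) (ΦM : Matrix ι ι R)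
    (π : (ι → R) →ₗ[R] M) (hπ : Function.Surjective π)
    (hk : LinearMap.ker π = LinearMap.range (Matrix.toLin' ΦM))
    (P P' U U' : Matrix ι ι (R ⊗[k] DegK k)) (hP : P * P' = 1) (hU : U * U' = 1)
    (hΦM : Φ.map (gK k R) =
      P * ΦM.map (Algebra.TensorProduct.includeLeftRingHom : R →+* R ⊗[k] DegK k) * U) :
    letI := vRestrict k R (cokQ Φ)
    ∃ f : LocalizedModule (Submonoid.powers (degT k)) (cokQ Φ) ≃+ (M ⊗[k] DegK k),
       (∀ (c : DegK k) (x : LocalizedModule (Submonoid.powers (degT k)) (cokQ Φ)),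
          f (c • x) = LinearMap.lTensor M (LinearMap.mulLeft k c) (f x)) ∧
       (∀ (r : R) (rr : M →ₗ[k] M), (∀ m, rr m = r • m) →
         ∀ (x : LocalizedModule (Submonoid.powers (degT k)) (cokQ Φ)),
          f (LocalizedModule.map (Submonoid.powers (degT k)) (rAct k R (cokQ Φ) r) x)
            = LinearMap.rTensor (DegK k) rr (f x)) := by
  let _ := vRestrict k R (cokQ Φ)
  obtain ⟨β, hβs, hβk, hβK, hβR⟩ := tensor_pi_coker (k := k) (K := DegK k) ΦM π hπ hk
  let g : (ι → R ⊗[k] DegV k) →+ (ι → R ⊗[k] DegK k) :=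
    { toFun := fun x j => gK k R (x j)
      map_zero' := by ext; simp
      map_add' := fun x y => by ext; simp }
  have hg : ∀ x j, g x j = gK k R (x j) := fun _ _ => rfl
  have hgs : ∀ a x, g (a • x) = gK k R a • g x := fun a x => by
    ext j
    simp [hg]
  have hgm : ∀ x, g (Φ.mulVec x) = (Φ.map (gK k R)).mulVec (g x) := by
    intro x
    ext j
    simp [hg, Matrix.mulVec, dotProduct]
  have hP' : P' * P = 1 := mul_eq_one_comm.mp hP
  let φ : (ι → R ⊗[k] DegV k) →+ M ⊗[k] DegK k := β.comp (((Matrix.mulVecLin P').toAddMonoidHom).comp g)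
  have hφ : ∀ x, φ x = β (P'.mulVec (g x)) := fun x => rfl
  obtain ⟨h, hh⟩ := exists_quot_lift (LinearMap.range (Matrix.toLin' Φ)) φ (by
    rintro _ ⟨z, rfl⟩
    rw [Matrix.toLin'_apply, hφ, hgm, hΦM, hβk, Matrix.mulVec_mulVec, Matrix.mul_assoc,
      ← Matrix.mul_assoc, hP', Matrix.one_mul, ← Matrix.mulVec_mulVec]
    exact ⟨_, rfl⟩)
  have main := loc_part (k := k) rhoK h ?_ ?_ ?_
  · obtain ⟨f, hf1, hf2⟩ := main
    refine ⟨f, hf1, fun r rr hr x => hf2 (rAct k R (cokQ Φ) r)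
      (LinearMap.rTensor (DegK k) rr).toAddMonoidHom ?_ ?_ x⟩
    · intro q
      obtain ⟨q, rfl⟩ := Submodule.mkQ_surjective _ q
      change h ((r ⊗ₜ[k] (1 : DegV k)) • Submodule.mkQ _ q) = _
      rw [← map_smul, hh, hφ, hgs, gK_tmul, Matrix.mulVec_smul, map_one, hβR r _ rr hr, hh, hφ]
      rfl
    · intro c w
      change LinearMap.rTensor (DegK k) rr (LinearMap.lTensor _ (LinearMap.mulLeft k c) w) = 
        LinearMap.lTensor _ (LinearMap.mulLeft k c) (LinearMap.rTensor (DegK k) rr w)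
      rw [← LinearMap.comp_apply, ← LinearMap.comp_apply, LinearMap.rTensor_comp_lTensor, LinearMap.lTensor_comp_rTensor]
  · intro v q
    obtain ⟨q, rfl⟩ := Submodule.mkQ_surjective _ q
    change h (((1 : R) ⊗ₜ[k] v) • Submodule.mkQ _ q) = _
    rw [← map_smul, hh, hφ, hgs, gK_tmul, Matrix.mulVec_smul, hβK, hh, hφ]
    rfl
  · intro w
    obtain ⟨z, rfl⟩ := hβs w
    obtain ⟨m, y, hy⟩ := gK_surj_pi k R (P.mulVec z)
    refine ⟨m, Submodule.mkQ _ y, ?_⟩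
    have : g y = gK k R (tA k R ^ m) • P.mulVec z := hy.symm
    rw [hh, hφ, this, Matrix.mulVec_smul, Matrix.mulVec_mulVec, hP', Matrix.one_mulVec, tA,
      Algebra.TensorProduct.tmul_pow, one_pow, gK_tmul, hβK]
    rfl
  · intro q hq
    obtain ⟨q, rfl⟩ := Submodule.mkQ_surjective _ q
    rw [hh, hφ, hβk] at hq
    obtain ⟨w, hw⟩ := hq
    have h1 : g q = (Φ.map (gK k R)).mulVec (U'.mulVec w) := by
      rw [hΦM, Matrix.mulVec_mulVec, Matrix.mul_assoc, hU, Matrix.mul_one, ← Matrix.mulVec_mulVec,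
        ← hw, Matrix.mulVec_mulVec, hP, Matrix.one_mulVec]
    obtain ⟨m, y, hy⟩ := gK_surj_pi k R (U'.mulVec w)
    have hy : g y = gK k R (tA k R ^ m) • U'.mulVec w := hy.symm
    have h2 : g (tA k R ^ m • q) = g (Φ.mulVec y) := by
      rw [hgs, hgm, hy, h1, Matrix.mulVec_smul]
    have h3 : tA k R ^ m • q = Φ.mulVec y := by
      ext j
      exact gK_injective k R (congrFun h2 j)
    refine ⟨m, ?_⟩
    change ((1 : R) ⊗ₜ[k] (degT k ^ m)) • Submodule.mkQ (LinearMap.range (Matrix.toLin' Φ)) q = 0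
    have h4 : ((1 : R) ⊗ₜ[k] (degT k ^ m)) = tA k R ^ m := by
      rw [tA, Algebra.TensorProduct.tmul_pow, one_pow]
    rw [h4, ← map_smul, h3, Submodule.mkQ_apply, Submodule.Quotient.mk_eq_zero]
    exact ⟨_, rfl⟩

theorem degenerates_of_matrix (Φ Ψ : Matrix ι ι (R ⊗[k] DegV k)) (ΦM ΦN : Matrix ι ι R)
    (hΦΨ : Φ * Ψ = 0) (hΦN : Φ.map (epsA k R) = ΦN)
    (hex : ∀ z, ΦN.mulVec z = 0 → ∃ w, z = (Ψ.map (epsA k R)).mulVec w)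
    (P P' U U' : Matrix ι ι (R ⊗[k] DegK k)) (hP : P * P' = 1) (hU : U * U' = 1)
    (hΦM : Φ.map (gK k R) =
      P * ΦM.map (Algebra.TensorProduct.includeLeftRingHom : R →+* R ⊗[k] DegK k) * U) :
    Degenerates k R ((ι → R) ⧸ LinearMap.range (Matrix.toLin' ΦM))
      ((ι → R) ⧸ LinearMap.range (Matrix.toLin' ΦN)) := by
  refine ⟨cokQ Φ, inferInstance, inferInstance, inferInstance, ?_, cokQ_mod_t Φ ΦN hΦN, ?_⟩
  · let := vRestrict k R (cokQ Φ)
    exact flat_of_t_regular fun q hq => cokQ_t_regular Φ Ψ ΦN hΦΨ hΦN hex q hq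
  · let := vRestrict k R (cokQ Φ)
    let instk : Module k ((ι → R) ⧸ LinearMap.range (Matrix.toLin' ΦM)) :=
      Module.compHom _ (algebraMap k R)
    have htower : @IsScalarTower k R ((ι → R) ⧸ LinearMap.range (Matrix.toLin' ΦM)) _ _ instk.toSMul :=
      @IsScalarTower.of_algebraMap_smul k R _ _ _ _ _ instk.toSMul (fun _ _ => rfl)
    obtain ⟨f, hf1, hf2⟩ := @cokQ_loc k R ι _ _ _ _ _
      ((ι → R) ⧸ LinearMap.range (Matrix.toLin' ΦM)) _ _ instk htower Φ ΦM
      (Submodule.mkQ _) (Submodule.mkQ_surjective _) (Submodule.ker_mkQ _) P P' U U' hP hU hΦM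
    exact ⟨f, hf1, fun r x => hf2 r (rActK k R _ r) (fun _ => rfl) x⟩
end


section
variable {C : Type} [CommRing C]

def nPhi (x y a b : C) (n : ℕ) : Matrix (Fin 2 ⊕ Fin 2) (Fin 2 ⊕ Fin 2) C :=
  Matrix.fromBlocks !![x, y ^ n; 0, -x] (a • (1 : Matrix (Fin 2) (Fin 2) C))
    (b • (1 : Matrix (Fin 2) (Fin 2) C)) !![x * y, y ^ (n + 1); 0, -(x * y)]

def tPhi (x y a b t : C) (n : ℕ) : Matrix (Fin 2 ⊕ Fin 2) (Fin 2 ⊕ Fin 2) C :=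
  Matrix.fromBlocks !![x + t * y ^ (n + 1), y ^ (n + 2); t ^ 2 * y ^ n, -x + t * y ^ (n + 1)]
    !![a, 0; 0, a] !![b, 0; 0, b]
    !![(x - t * y ^ (n + 1)) * y, y ^ (n + 3); t ^ 2 * y ^ (n + 1), (-x - t * y ^ (n + 1)) * y]

def tPsi (x y a b t : C) (n : ℕ) : Matrix (Fin 2 ⊕ Fin 2) (Fin 2 ⊕ Fin 2) C :=
  Matrix.fromBlocks
    !![(x - t * y ^ (n + 1)) * y, y ^ (n + 3); t ^ 2 * y ^ (n + 1), (-x - t * y ^ (n + 1)) * y]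
    !![-a, 0; 0, -a] !![-b, 0; 0, -b]
    !![x + t * y ^ (n + 1), y ^ (n + 2); t ^ 2 * y ^ n, -x + t * y ^ (n + 1)]

def matP (y t s : C) : Matrix (Fin 2) (Fin 2) C := !![y, s; -t, 0]
def matP' (y t s : C) : Matrix (Fin 2) (Fin 2) C := !![0, -s; t, y]

theorem smul_one_two (a : C) : a • (1 : Matrix (Fin 2) (Fin 2) C) = !![a, 0; 0, a] := by
  ext i j
  fin_cases i <;> fin_cases j <;> simp

theorem smul_one_four (a : C) : a • (1 : Matrix (Fin 2 ⊕ Fin 2) (Fin 2 ⊕ Fin 2) C) =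
    Matrix.fromBlocks !![a, 0; 0, a] !![0, 0; 0, 0] !![0, 0; 0, 0] !![a, 0; 0, a] := by
  rw [← Matrix.fromBlocks_one, Matrix.fromBlocks_smul, smul_one_two]
  congr 1 <;> ext i j <;> fin_cases i <;> fin_cases j <;> simp

theorem tPhi_mul_tPsi (x y a b t : C) (n : ℕ) :
    tPhi x y a b t n * tPsi x y a b t n = (x ^ 2 * y - a * b) • 1 := by
  rw [tPhi, tPsi, Matrix.fromBlocks_multiply, smul_one_four]
  congr 1 <;> ext i j <;> fin_cases i <;> fin_cases j <;> simp <;> ring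

theorem tPsi_mul_tPhi (x y a b t : C) (n : ℕ) :
    tPsi x y a b t n * tPhi x y a b t n = (x ^ 2 * y - a * b) • 1 := by
  rw [tPhi, tPsi, Matrix.fromBlocks_multiply, smul_one_four]
  congr 1 <;> ext i j <;> fin_cases i <;> fin_cases j <;> simp <;> ring

theorem tPhi_zero (x y a b : C) (n : ℕ) : tPhi x y a b 0 n = nPhi x y a b (n + 2) := by
  rw [tPhi, nPhi, smul_one_two, smul_one_two]
  congr 1 <;> ext i j <;> fin_cases i <;> fin_cases j <;> simp

theorem tPhi_map {D : Type} [CommRing D] (f : C →+* D) (x y a b t : C) (n : ℕ) :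
    (tPhi x y a b t n).map f = tPhi (f x) (f y) (f a) (f b) (f t) n := by
  rw [tPhi, tPhi, Matrix.fromBlocks_map]
  congr 1 <;> ext i j <;> fin_cases i <;> fin_cases j <;> simp

theorem tPsi_map {D : Type} [CommRing D] (f : C →+* D) (x y a b t : C) (n : ℕ) :
    (tPsi x y a b t n).map f = tPsi (f x) (f y) (f a) (f b) (f t) n := by
  rw [tPsi, tPsi, Matrix.fromBlocks_map]
  congr 1 <;> ext i j <;> fin_cases i <;> fin_cases j <;> simp

theorem nPhi_map {D : Type} [CommRing D] (f : C →+* D) (x y a b : C) (n : ℕ) :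
    (nPhi x y a b n).map f = nPhi (f x) (f y) (f a) (f b) n := by
  rw [nPhi, nPhi, Matrix.fromBlocks_map]
  simp only [smul_one_two]
  congr 1 <;> ext i j <;> fin_cases i <;> fin_cases j <;> simp

theorem matP_mul (y t s : C) (h : t * s = 1) : matP y t s * matP' y t s = 1 := by
  ext i j
  fin_cases i <;> fin_cases j <;> simp [matP, matP'] <;> grind

theorem diag_mul_one {A B A' B' : Matrix (Fin 2) (Fin 2) C} (h : A * A' = 1) (h' : B * B' = 1) :
    Matrix.fromBlocks A 0 0 B * Matrix.fromBlocks A' 0 0 B' = 1 := by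
  rw [Matrix.fromBlocks_multiply]
  simp [h, h']

theorem tPhi_conj (x y a b t s : C) (n : ℕ) (h : t * s = 1) :
    tPhi x y a b t n = Matrix.fromBlocks (matP y (-t) (-s)) 0 0 (matP y t s) * nPhi x y a b n *
      Matrix.fromBlocks (matP' y t s) 0 0 (matP' y (-t) (-s)) := by
  rw [tPhi, nPhi, Matrix.fromBlocks_multiply, Matrix.fromBlocks_multiply]
  simp only [smul_one_two, matP, matP']
  congr 1 <;> ext i j <;> fin_cases i <;> fin_cases j <;> simp <;> grind

theorem quot_exact {ι : Type} [Fintype ι] [DecidableEq ι] [IsDomain C] (f : C) (hf : f ≠ 0)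
    (Φ Ψ : Matrix ι ι C) (h' : Ψ * Φ = f • 1)
    (z : ι → C ⧸ Ideal.span {f})
    (hz : (Φ.map (Ideal.Quotient.mk (Ideal.span {f}))).mulVec z = 0) :
    ∃ w, z = (Ψ.map (Ideal.Quotient.mk (Ideal.span {f}))).mulVec w := by
  choose z0 hz0 using fun j => Ideal.Quotient.mk_surjective (z j)
  have hm : ∀ (B : Matrix ι ι C) (x : ι → C) (j),
      Ideal.Quotient.mk (Ideal.span {f}) (B.mulVec x j) =
        (B.map (Ideal.Quotient.mk (Ideal.span {f}))).mulVec
          (fun j => Ideal.Quotient.mk (Ideal.span {f}) (x j)) j := by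
    intro B x j
    simp [Matrix.mulVec, dotProduct]
  have hz1 : (fun j => Ideal.Quotient.mk (Ideal.span {f}) (z0 j)) = z := funext hz0
  have h1 : ∀ j, ∃ w, Φ.mulVec z0 j = f * w := by
    intro j
    have : Ideal.Quotient.mk (Ideal.span {f}) (Φ.mulVec z0 j) = 0 := by
      rw [hm, hz1, hz, Pi.zero_apply]
    rw [Ideal.Quotient.eq_zero_iff_mem, Ideal.mem_span_singleton] at this
    exact this
  choose w hw using h1
  have h2 : Φ.mulVec z0 = f • w := funext hw
  have h3 : f • z0 = f • Ψ.mulVec w := by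
    rw [← Matrix.mulVec_smul, ← h2, Matrix.mulVec_mulVec, h', Matrix.smul_mulVec, Matrix.one_mulVec]
  refine ⟨fun j => Ideal.Quotient.mk (Ideal.span {f}) (w j), ?_⟩
  ext j
  rw [← hm, ← hz0]
  congr 1
  exact mul_left_cancel₀ hf (congrFun h3 j)
end

abbrev fS (k : Type) [Field k] : MvPowerSeries (Fin 4) k :=
  (MvPowerSeries.X (0 : Fin 4) : MvPowerSeries (Fin 4) k) ^ 2 * (MvPowerSeries.X (1 : Fin 4) : MvPowerSeries (Fin 4) k) +
      (MvPowerSeries.X (2 : Fin 4) : MvPowerSeries (Fin 4) k) ^ 2 + (MvPowerSeries.X (3 : Fin 4) : MvPowerSeries (Fin 4) k) ^ 2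

theorem fS_ne_zero (k : Type) [Field k] : fS k ≠ 0 := by
  intro h
  have h1 := congrArg (MvPowerSeries.coeff (Finsupp.single (2 : Fin 4) 2)) h
  have e0 : MvPowerSeries.coeff (Finsupp.single (2 : Fin 4) 2)
      ((MvPowerSeries.X (0 : Fin 4) : MvPowerSeries (Fin 4) k) ^ 2 * (MvPowerSeries.X (1 : Fin 4) : MvPowerSeries (Fin 4) k)) = 0 := by
    rw [MvPowerSeries.X_pow_eq, MvPowerSeries.X, MvPowerSeries.monomial_mul_monomial, MvPowerSeries.coeff_monomial, if_neg]
    intro h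
    have := DFunLike.congr_fun h 2
    simp [Finsupp.single_apply] at this
  simp only [fS, map_add, e0, MvPowerSeries.coeff_X_pow] at h1
  rw [if_pos trivial, if_neg] at h1
  · simp at h1
  · intro h
    have := DFunLike.congr_fun h 2
    simp [Finsupp.single_apply] at this

theorem degenerates_generic {k R : Type} [Field k] [CommRing R] [Algebra k R] (x y a b : R) (n : ℕ)
    (hfS : x ^ 2 * y - a * b = 0)
    (hex : ∀ z, (nPhi x y a b (n + 2)).mulVec z = 0 → ∃ w, z = (tPsi x y a b 0 n).mulVec w) :
    Degenerates k R ((Fin 2 ⊕ Fin 2 → R) ⧸ LinearMap.range (Matrix.toLin' (nPhi x y a b n)))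
      ((Fin 2 ⊕ Fin 2 → R) ⧸ LinearMap.range (Matrix.toLin' (nPhi x y a b (n + 2)))) := by
  let ι : R →+* R ⊗[k] DegV k := Algebra.TensorProduct.includeLeftRingHom
  let κ : R →+* R ⊗[k] DegK k := Algebra.TensorProduct.includeLeftRingHom
  let t := tA k R
  have hei : ∀ r, epsA k R (ι r) = r := epsA_left k R
  have hgi : ∀ r, gK k R (ι r) = κ r := fun r => by
    change gK k R (r ⊗ₜ 1) = r ⊗ₜ 1
    rw [gK_tmul, map_one]
  let c : DegK k := IsLocalization.mk' (DegK k) (1 : DegV k) (⟨degT k, 1, pow_one _⟩ : Submonoid.powers (degT k))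
  let T := gK k R t
  let s : R ⊗[k] DegK k := 1 ⊗ₜ c
  have hts : T * s = 1 := by
    simp only [T, t, s, tA]
    rw [gK_tmul, Algebra.TensorProduct.tmul_mul_tmul, one_mul, Algebra.TensorProduct.one_def]
    congr 1
    have := IsLocalization.mk'_spec' (DegK k) (1 : DegV k) (⟨degT k, 1, pow_one _⟩ : Submonoid.powers (degT k))
    rw [map_one] at this
    exact this
  have hts' : (-T) * (-s) = 1 := by rw [neg_mul_neg, hts]
  refine degenerates_of_matrix (tPhi (ι x) (ι y) (ι a) (ι b) t n) (tPsi (ι x) (ι y) (ι a) (ι b) t n)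
    (nPhi x y a b n) (nPhi x y a b (n + 2)) ?_ ?_ ?_
    (Matrix.fromBlocks (matP (κ y) (-T) (-s)) 0 0 (matP (κ y) T s))
    (Matrix.fromBlocks (matP' (κ y) (-T) (-s)) 0 0 (matP' (κ y) T s))
    (Matrix.fromBlocks (matP' (κ y) T s) 0 0 (matP' (κ y) (-T) (-s)))
    (Matrix.fromBlocks (matP (κ y) T s) 0 0 (matP (κ y) (-T) (-s)))
    (diag_mul_one (matP_mul _ _ _ hts') (matP_mul _ _ _ hts))
    (diag_mul_one (mul_eq_one_comm.mp (matP_mul _ _ _ hts)) (mul_eq_one_comm.mp (matP_mul _ _ _ hts'))) ?_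
  · rw [tPhi_mul_tPsi, ← map_pow, ← map_mul, ← map_mul, ← map_sub, hfS, map_zero, zero_smul]
  · have := tPhi_map (epsA k R : R ⊗[k] DegV k →+* R) (ι x) (ι y) (ι a) (ι b) t n
    refine this.trans ?_
    change tPhi (epsA k R (ι x)) (epsA k R (ι y)) (epsA k R (ι a))
      (epsA k R (ι b)) (epsA k R t) n = _
    rw [hei, hei, hei, hei, epsA_t, tPhi_zero]
  · intro z hz
    have e2 : (tPsi (ι x) (ι y) (ι a) (ι b) t n).map (epsA k R) = tPsi x y a b 0 n := by
      refine (tPsi_map (epsA k R : R ⊗[k] DegV k →+* R) (ι x) (ι y) (ι a) (ι b) t n).trans ?_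
      change tPsi (epsA k R (ι x)) (epsA k R (ι y)) (epsA k R (ι a))
        (epsA k R (ι b)) (epsA k R t) n = _
      rw [hei, hei, hei, hei, epsA_t]
    rw [e2]
    exact hex z hz
  · refine (tPhi_map (gK k R : R ⊗[k] DegV k →+* R ⊗[k] DegK k) (ι x) (ι y) (ι a) (ι b) t n).trans ?_
    change tPhi (gK k R (ι x)) (gK k R (ι y)) (gK k R (ι a))
      (gK k R (ι b)) T n = _
    rw [hgi, hgi, hgi, hgi, tPhi_conj _ _ _ _ _ s n hts]
    congr 2
    exact (nPhi_map κ x y a b n).symm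

theorem Nmod_degeneration (k : Type) [Field k] (i : k) (hi : i ^ 2 = -1)
    (h2 : (2 : k) ≠ 0) (n : ℕ) (hn : 1 ≤ n) :
    Degenerates k (DinfRing3 k) (Nmod k i n) (Nmod k i (n + 2)) := by
  let x := sx k
  let y := sy k
  let a := su k + algebraMap k (DinfRing3 k) i * sv k
  let b := -su k + algebraMap k (DinfRing3 k) i * sv k
  let X0 : MvPowerSeries (Fin 4) k := MvPowerSeries.X 0
  let Y0 : MvPowerSeries (Fin 4) k := MvPowerSeries.X 1
  let a0 : MvPowerSeries (Fin 4) k := MvPowerSeries.X 2 + algebraMap k _ i * MvPowerSeries.X 3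
  let b0 : MvPowerSeries (Fin 4) k := -MvPowerSeries.X 2 + algebraMap k _ i * MvPowerSeries.X 3
  have hf0 : X0 ^ 2 * Y0 - a0 * b0 = fS k := by
    have : (algebraMap k (MvPowerSeries (Fin 4) k) i) ^ 2 = -1 := by
      rw [← map_pow, hi, map_neg, map_one]
    simp only [X0, Y0, a0, b0, fS]
    linear_combination (-(MvPowerSeries.X 3 : MvPowerSeries (Fin 4) k) ^ 2) * this
  let q := Ideal.Quotient.mk (Ideal.span {fS k})
  have hqx : q X0 = x := rfl
  have hqy : q Y0 = y := rfl
  have hqa : q a0 = a := by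
    simp only [a0, map_add, map_mul]
    rfl
  have hqb : q b0 = b := by
    simp only [b0, map_add, map_mul, map_neg]
    rfl
  have hfS : x ^ 2 * y - a * b = 0 := by
    rw [← hqx, ← hqy, ← hqa, ← hqb, ← map_pow, ← map_mul, ← map_mul, ← map_sub, hf0]
    exact Ideal.Quotient.eq_zero_iff_mem.mpr (Ideal.mem_span_singleton_self _)
  have hdom : IsDomain (MvPowerSeries (Fin 4) k) := NoZeroDivisors.to_isDomain _
  refine degenerates_generic x y a b n hfS ?_
  intro z hz
  have e1 : nPhi x y a b (n + 2) = (tPhi X0 Y0 a0 b0 0 n).map q := by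
    rw [tPhi_map, hqx, hqy, hqa, hqb, map_zero, tPhi_zero]
  have e2 : tPsi x y a b 0 n = (tPsi X0 Y0 a0 b0 0 n).map q := by
    rw [tPsi_map, hqx, hqy, hqa, hqb, map_zero]
  rw [e1] at hz
  rw [e2]
  exact quot_exact (fS k) (fS_ne_zero k) _ _ (by rw [tPsi_mul_tPhi, hf0]) z hz
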